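/- Let u : ℝ × ℝ → ℝ be smooth, suppose u and all its partial derivatives decay rapidly in x (faster than any power of 1/|x|) locally uniformly in t, and suppose u satisfies the KdV equation u_t − 6uu_x + u_{xxx} = 0. Then the function t ↦ ∫_ℝ ( u_x(x,t)² + 2u(x,t)³ ) dx is constant. -/

import Mathlib

open MeasureTheory

/-- `u` and all its partial derivatives decay rapidly in `x` (faster than any power of
`1/|x|`), locally uniformly in `t`. Here `u x t` has space variable `x` and time `t`. -/
def RapidlyDecayingInX (u : ℝ → ℝ → ℝ) : Prop :=
  ∀ i j n : ℕ, ∀ a b : ℝ, ∃ C : ℝ, ∀ t ∈ Set.Icc a b, ∀ x : ℝ,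
    |x| ^ n * |iteratedDeriv i (fun x' => iteratedDeriv j (u x') t) x| ≤ C

/-- The partial derivative of `f` in its first variable. -/
noncomputable def partialX (f : ℝ → ℝ → ℝ) (x t : ℝ) : ℝ := deriv (fun y => f y t) x

/-- The partial derivative of `f` in its second variable. -/
noncomputable def partialT (f : ℝ → ℝ → ℝ) (x t : ℝ) : ℝ := deriv (f x) t

section Partial

variable {f : ℝ → ℝ → ℝ}

theorem hasDerivAt_fst_of_contDiff (hf : ContDiff ℝ (⊤ : ℕ∞) (Function.uncurry f)) (x t : ℝ) :
    HasDerivAt (fun y => f y t) (fderiv ℝ (Function.uncurry f) (x, t) (1, 0)) x :=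
  ((hf.differentiable (by simp)) (x, t)).hasFDerivAt.comp_hasDerivAt (f := fun y => (y, t)) x
    ((hasDerivAt_id x).prodMk (hasDerivAt_const x t))

theorem hasDerivAt_snd_of_contDiff (hf : ContDiff ℝ (⊤ : ℕ∞) (Function.uncurry f)) (x t : ℝ) :
    HasDerivAt (f x) (fderiv ℝ (Function.uncurry f) (x, t) (0, 1)) t :=
  ((hf.differentiable (by simp)) (x, t)).hasFDerivAt.comp_hasDerivAt (f := fun s => (x, s)) t
    ((hasDerivAt_const t x).prodMk (hasDerivAt_id t))

theorem hasDerivAt_partialX (hf : ContDiff ℝ (⊤ : ℕ∞) (Function.uncurry f)) (x t : ℝ) :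
    HasDerivAt (fun y => f y t) (partialX f x t) x :=
  (hasDerivAt_fst_of_contDiff hf x t).differentiableAt.hasDerivAt

theorem hasDerivAt_partialT (hf : ContDiff ℝ (⊤ : ℕ∞) (Function.uncurry f)) (x t : ℝ) :
    HasDerivAt (f x) (partialT f x t) t :=
  (hasDerivAt_snd_of_contDiff hf x t).differentiableAt.hasDerivAt

theorem uncurry_partialX (hf : ContDiff ℝ (⊤ : ℕ∞) (Function.uncurry f)) :
    Function.uncurry (partialX f) = fun p => fderiv ℝ (Function.uncurry f) p (1, 0) :=
  funext fun p => (hasDerivAt_fst_of_contDiff hf p.1 p.2).deriv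

theorem uncurry_partialT (hf : ContDiff ℝ (⊤ : ℕ∞) (Function.uncurry f)) :
    Function.uncurry (partialT f) = fun p => fderiv ℝ (Function.uncurry f) p (0, 1) :=
  funext fun p => (hasDerivAt_snd_of_contDiff hf p.1 p.2).deriv

theorem contDiff_partialX (hf : ContDiff ℝ (⊤ : ℕ∞) (Function.uncurry f)) :
    ContDiff ℝ (⊤ : ℕ∞) (Function.uncurry (partialX f)) := by
  rw [uncurry_partialX hf]
  exact (hf.fderiv_right (by simp)).clm_apply contDiff_const

theorem contDiff_partialT (hf : ContDiff ℝ (⊤ : ℕ∞) (Function.uncurry f)) :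
    ContDiff ℝ (⊤ : ℕ∞) (Function.uncurry (partialT f)) := by
  rw [uncurry_partialT hf]
  exact (hf.fderiv_right (by simp)).clm_apply contDiff_const

theorem partialT_partialX (hf : ContDiff ℝ (⊤ : ℕ∞) (Function.uncurry f)) (x t : ℝ) :
    partialT (partialX f) x t = partialX (partialT f) x t := by
  have hd : DifferentiableAt ℝ (fderiv ℝ (Function.uncurry f)) (x, t) :=
    ((hf.fderiv_right (m := (⊤ : ℕ∞)) (by simp)).differentiable (by simp)) (x, t)
  have hsymm : IsSymmSndFDerivAt ℝ (Function.uncurry f) (x, t) :=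
    hf.contDiffAt.isSymmSndFDerivAt (by
      rw [minSmoothness_of_isRCLikeNormedField]; exact WithTop.coe_le_coe.2 le_top)
  rw [partialT, (hasDerivAt_snd_of_contDiff (contDiff_partialX hf) x t).deriv, partialX,
    (hasDerivAt_fst_of_contDiff (contDiff_partialT hf) x t).deriv, uncurry_partialX hf,
    uncurry_partialT hf, fderiv_clm_apply hd (differentiableAt_const _),
    fderiv_clm_apply hd (differentiableAt_const _)]
  simpa using hsymm.eq (0, 1) (1, 0)

end Partial

theorem integrable_of_abs_le_div_one_add_sq {g : ℝ → ℝ} (hg : Continuous g) {K : ℝ}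
    (h : ∀ x, |g x| ≤ K * (1 + x ^ 2)⁻¹) : Integrable g :=
  (integrable_inv_one_add_sq.const_mul K).mono' hg.aestronglyMeasurable (.of_forall h)

/-- A product of two quantities bounded by multiples of a weight `w ≤ 1` is bounded by a
multiple of `w`. -/
theorem abs_mul_le_of_abs_le {a b A B w : ℝ} (hw : w ≤ 1) (hA : 0 ≤ A) (hB : 0 ≤ B)
    (hw0 : 0 ≤ w) (ha : |a| ≤ A * w) (hb : |b| ≤ B * w) : |a * b| ≤ A * B * w := by
  rw [abs_mul]
  calc |a| * |b| ≤ (A * w) * (B * w) := by gcongr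
    _ = A * B * w * w := by ring
    _ ≤ A * B * w := mul_le_of_le_one_right (by positivity) hw

theorem RapidlyDecayingInX.exists_bound {u : ℝ → ℝ → ℝ} (hu : RapidlyDecayingInX u)
    (i j : ℕ) (a b : ℝ) : ∃ C, 0 ≤ C ∧ ∀ t ∈ Set.Icc a b, ∀ x : ℝ,
      |iteratedDeriv i (fun x' => iteratedDeriv j (u x') t) x| ≤ C * (1 + x ^ 2)⁻¹ := by
  obtain ⟨C₀, h₀⟩ := hu i j 0 a b
  obtain ⟨C₂, h₂⟩ := hu i j 2 a b
  refine ⟨|C₀ + C₂|, abs_nonneg _, fun t ht x => ?_⟩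
  have h₀ := h₀ t ht x
  have h₂ := h₂ t ht x
  rw [← div_eq_mul_inv, le_div_iff₀ (by positivity)]
  rw [sq_abs] at h₂
  linarith [le_abs_self (C₀ + C₂)]

theorem hasDerivAt_kdv_third_integral {u : ℝ → ℝ → ℝ}
    (hu : ContDiff ℝ (⊤ : ℕ∞) (Function.uncurry u)) (hdecay : RapidlyDecayingInX u)
    (hkdv : ∀ x t, partialT u x t - 6 * u x t * partialX u x t
      + partialX (partialX (partialX u)) x t = 0) (t : ℝ) :
    HasDerivAt (fun s => ∫ x, (partialX u x s ^ 2 + 2 * u x s ^ 3)) 0 t := by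
  have hux := contDiff_partialX hu
  have huxx := contDiff_partialX hux
  have hut := contDiff_partialT hu
  have hutx := contDiff_partialX hut
  have cont {f : ℝ → ℝ → ℝ} (hf : ContDiff ℝ (⊤ : ℕ∞) (Function.uncurry f)) (s : ℝ) :
      Continuous fun x => f x s :=
    hf.continuous.comp (Continuous.prodMk_left s)
  obtain ⟨A, hA, hAb⟩ := hdecay.exists_bound 0 0 (t - 1) (t + 1)
  obtain ⟨B, hB, hBb⟩ := hdecay.exists_bound 1 0 (t - 1) (t + 1)
  obtain ⟨C, hC, hCb⟩ := hdecay.exists_bound 2 0 (t - 1) (t + 1)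
  obtain ⟨D, hD, hDb⟩ := hdecay.exists_bound 0 1 (t - 1) (t + 1)
  obtain ⟨E, hE, hEb⟩ := hdecay.exists_bound 1 1 (t - 1) (t + 1)
  simp only [iteratedDeriv_zero, iteratedDeriv_succ] at hAb hBb hCb hDb hEb
  change ∀ s ∈ _, ∀ x, |partialX u x s| ≤ _ at hBb
  change ∀ s ∈ _, ∀ x, |partialX (partialX u) x s| ≤ _ at hCb
  change ∀ s ∈ _, ∀ x, |partialT u x s| ≤ _ at hDb
  change ∀ s ∈ _, ∀ x, |partialX (partialT u) x s| ≤ _ at hEb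
  have hw (x : ℝ) : (1 + x ^ 2)⁻¹ ≤ 1 := inv_le_one_of_one_le₀ (by nlinarith [sq_nonneg x])
  have hw0 (x : ℝ) : 0 ≤ (1 + x ^ 2)⁻¹ := by positivity
  have ht : t ∈ Set.Icc (t - 1) (t + 1) := ⟨by linarith, by linarith⟩
  have hF_int : Integrable fun x => partialX u x t ^ 2 + 2 * u x t ^ 3 := by
    refine integrable_of_abs_le_div_one_add_sq (K := B * B + 2 * (A * A * A))
      (by have := cont hux t; have := cont hu t; fun_prop) fun x => ?_
    have h₁ := abs_mul_le_of_abs_le (hw x) hB hB (hw0 x) (hBb t ht x) (hBb t ht x)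
    have h₂ := abs_mul_le_of_abs_le (hw x) hA hA (hw0 x) (hAb t ht x) (hAb t ht x)
    have h₃ := abs_mul_le_of_abs_le (hw x) (by positivity) hA (hw0 x) h₂ (hAb t ht x)
    rw [abs_le] at h₁ h₃ ⊢
    constructor <;> linarith
  have hF'_bound : ∀ s ∈ Set.Icc (t - 1) (t + 1), ∀ x,
      |2 * partialX u x s * partialX (partialT u) x s + 6 * u x s ^ 2 * partialT u x s|
        ≤ (2 * (B * E) + 6 * (A * A * D)) * (1 + x ^ 2)⁻¹ := by
    intro s hs x
    have h₁ := abs_mul_le_of_abs_le (hw x) hB hE (hw0 x) (hBb s hs x) (hEb s hs x)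
    have h₂ := abs_mul_le_of_abs_le (hw x) hA hA (hw0 x) (hAb s hs x) (hAb s hs x)
    have h₃ := abs_mul_le_of_abs_le (hw x) (by positivity) hD (hw0 x) h₂ (hDb s hs x)
    rw [abs_le] at h₁ h₃ ⊢
    constructor <;> linarith
  have hF'_cont : Continuous fun x =>
      2 * partialX u x t * partialX (partialT u) x t + 6 * u x t ^ 2 * partialT u x t := by
    have := cont hux t
    have := cont hu t
    have := cont hut t
    have := cont hutx t
    fun_prop
  have hflux_int : Integrable fun x =>
      2 * (partialX u x t * partialT u x t)
        + (3 * u x t ^ 2 - partialX (partialX u) x t) ^ 2 := by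
    refine integrable_of_abs_le_div_one_add_sq
      (K := 2 * (B * D) + (3 * (A * A) + C) * (3 * (A * A) + C))
      (by have := cont hux t; have := cont hu t; have := cont hut t; have := cont huxx t
          fun_prop) fun x => ?_
    have h₁ := abs_mul_le_of_abs_le (hw x) hB hD (hw0 x) (hBb t ht x) (hDb t ht x)
    have h₂ := abs_mul_le_of_abs_le (hw x) hA hA (hw0 x) (hAb t ht x) (hAb t ht x)
    have h₃ : |3 * u x t ^ 2 - partialX (partialX u) x t|
        ≤ (3 * (A * A) + C) * (1 + x ^ 2)⁻¹ := by
      have h₄ := hCb t ht x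
      rw [abs_le] at h₂ h₄ ⊢
      constructor <;> linarith
    have h₅ := abs_mul_le_of_abs_le (hw x) (by positivity) (by positivity) (hw0 x) h₃ h₃
    rw [abs_le] at h₁ h₅ ⊢
    constructor <;> linarith
  have hflux_deriv (x : ℝ) : HasDerivAt (fun x =>
      2 * (partialX u x t * partialT u x t)
        + (3 * u x t ^ 2 - partialX (partialX u) x t) ^ 2)
      (2 * partialX u x t * partialX (partialT u) x t + 6 * u x t ^ 2 * partialT u x t) x := by
    have h := (((hasDerivAt_partialX hux x t).mul (hasDerivAt_partialX hut x t)).const_mul 2).add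
      (((((hasDerivAt_partialX hu x t).pow 2).const_mul 3).sub
        (hasDerivAt_partialX huxx x t)).pow 2)
    refine h.congr_deriv ?_
    have hk : partialX (partialX (partialX u)) x t
        = 6 * u x t * partialX u x t - partialT u x t := by linarith [hkdv x t]
    simp [hk]
    ring
  have hzero : ∫ x, (2 * partialX u x t * partialX (partialT u) x t
      + 6 * u x t ^ 2 * partialT u x t) = 0 :=
    integral_eq_zero_of_hasDerivAt_of_integrable hflux_deriv
      (integrable_of_abs_le_div_one_add_sq hF'_cont (hF'_bound t ht)) hflux_int
  rw [← hzero]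
  refine (hasDerivAt_integral_of_dominated_loc_of_deriv_le
    (F := fun s x => partialX u x s ^ 2 + 2 * u x s ^ 3)
    (F' := fun s x => 2 * partialX u x s * partialX (partialT u) x s
      + 6 * u x s ^ 2 * partialT u x s)
    (Icc_mem_nhds (by linarith : t - 1 < t) (by linarith : t < t + 1))
    (.of_forall fun s => ?_) hF_int hF'_cont.aestronglyMeasurable
    (.of_forall fun x s hs => hF'_bound s hs x)
    (integrable_inv_one_add_sq.const_mul _) (.of_forall fun x s _ => ?_)).2
  · have := cont hux s
    have := cont hu s
    exact Continuous.aestronglyMeasurable (by fun_prop)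
  · have h := ((hasDerivAt_partialT hux x s).pow 2).add
      (((hasDerivAt_partialT hu x s).pow 3).const_mul 2)
    refine h.congr_deriv ?_
    rw [partialT_partialX hu]
    simp
    ring

/-- For a smooth, rapidly decaying solution of the KdV equation
`u_t − 6uu_x + u_{xxx} = 0`, the Hamiltonian functional
`t ↦ ∫_ℝ (u_x(x,t)² + 2u(x,t)³) dx` is constant. -/
theorem kdv_third_integral (u : ℝ → ℝ → ℝ)
    (hsmooth : ContDiff ℝ (⊤ : ℕ∞) (Function.uncurry u))
    (hdecay : RapidlyDecayingInX u)
    (hkdv : ∀ x t : ℝ,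
      deriv (fun t' => u x t') t
        - 6 * u x t * deriv (fun x' => u x' t) x
        + deriv (deriv (deriv (fun x' => u x' t))) x = 0) :
    ∀ t₁ t₂ : ℝ,
      ∫ x : ℝ, ((deriv (fun x' => u x' t₁) x) ^ 2 + 2 * (u x t₁) ^ 3)
        = ∫ x : ℝ, ((deriv (fun x' => u x' t₂) x) ^ 2 + 2 * (u x t₂) ^ 3) := by
  have h := hasDerivAt_kdv_third_integral hsmooth hdecay hkdv
  exact is_const_of_deriv_eq_zero (fun t => (h t).differentiableAt) fun t => (h t).deriv
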